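/- In Pic(S_7) ≅ ℤ^8, there are exactly 126 rulings (classes D_1 + D_2 with D_1, D_2 (-1)-classes and D_1·D_2 = 1), and each ruling can be written as such a sum in exactly 6 unordered ways. -/

import Mathlib

open Finset

/-- Intersection form on Pic = ℤ^8 with matrix diag(1,-1,...,-1). -/
def dot (x y : Fin 8 → ℤ) : ℤ := x 0 * y 0 - ∑ i : Fin 7, x i.succ * y i.succ

/-- The canonical class K = (-3,1,...,1). -/
def K : Fin 8 → ℤ := fun i => if i = 0 then -3 else 1

/-- A (-1)-class: D·D = -1 and D·K = -1. -/
def isNegClass (D : Fin 8 → ℤ) : Prop := dot D D = -1 ∧ dot D K = -1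

/-- A ruling: a sum of two (-1)-classes with intersection number 1. -/
def IsRuling (R : Fin 8 → ℤ) : Prop :=
  ∃ D1 D2, isNegClass D1 ∧ isNegClass D2 ∧ dot D1 D2 = 1 ∧ R = D1 + D2

lemma dot_comm (x y : Fin 8 → ℤ) : dot x y = dot y x := by
  simp only [dot, mul_comm]

lemma dot_add_left (x y z : Fin 8 → ℤ) : dot (x + y) z = dot x z + dot y z := by
  simp only [dot, Pi.add_apply, add_mul, sum_add_distrib]
  ring

lemma dot_sub_left (x y z : Fin 8 → ℤ) : dot (x - y) z = dot x z - dot y z := by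
  rw [eq_sub_iff_add_eq, ← dot_add_left, sub_add_cancel]

lemma dot_self (x : Fin 8 → ℤ) : dot x x = x 0 ^ 2 - ∑ i : Fin 7, x i.succ ^ 2 := by
  simp only [dot, sq]

lemma dot_K (x : Fin 8 → ℤ) : dot x K = -3 * x 0 - ∑ i : Fin 7, x i.succ := by
  simp [dot, K, mul_comm]

/-- The intersection form on coordinate lists. -/
def listDot (l m : List ℤ) : ℤ :=
  l.headD 0 * m.headD 0 - (List.zipWith (· * ·) l.tail m.tail).sum

lemma listDot_ofFn (x y : Fin 8 → ℤ) : listDot (List.ofFn x) (List.ofFn y) = dot x y := by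
  simp [listDot, dot, List.ofFn_succ, Fin.sum_univ_succ]

/-- Coordinate lists with first entry `d` and the seven remaining entries in `v`. -/
def candidates (d : ℤ) (v : List ℤ) : List (List ℤ) :=
  ([d] :: List.replicate 7 v).sections

lemma ofFn_mem_candidates {x : Fin 8 → ℤ} {d : ℤ} {v : List ℤ} (hd : x 0 = d)
    (hv : ∀ i : Fin 7, x i.succ ∈ v) : List.ofFn x ∈ candidates d v := by
  simp only [Fin.forall_fin_succ, IsEmpty.forall_iff, and_true] at hv
  simp only [candidates, List.mem_sections, List.ofFn_succ, List.ofFn_zero, List.replicate,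
    List.forall₂_cons, List.forall₂_nil_left_iff, and_true]
  exact ⟨List.mem_singleton.2 hd, hv⟩

/-- Coordinate lists of the (-1)-classes. -/
def negList : List (List ℤ) :=
  (candidates 0 [0, 1] ++ candidates 1 [-1, 0] ++ candidates 2 [-1, 0] ++
    candidates 3 [-2, -1]).filter
    fun l => listDot l l = -1 ∧ listDot l [-3, 1, 1, 1, 1, 1, 1, 1] = -1

/-- Coordinate lists of the classes `R` with `R·R = 0` and `R·K = -2`. -/
def rulingList : List (List ℤ) :=
  (candidates 1 [-1, 0] ++ candidates 2 [-1, 0] ++ candidates 3 [-2, -1, 0] ++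
    candidates 4 [-2, -1] ++ candidates 5 [-2, -1]).filter
    fun l => listDot l l = 0 ∧ listDot l [-3, 1, 1, 1, 1, 1, 1, 1] = -2

lemma ofFn_K : List.ofFn K = [-3, 1, 1, 1, 1, 1, 1, 1] := by decide

lemma mul_succ_nonneg (a : ℤ) : 0 ≤ a * (a + 1) := by
  rcases le_or_gt 0 a with h | h <;> nlinarith

/-- An integer vector whose power sums match those of a `{c, c + 1}`-valued one
is itself `{c, c + 1}`-valued. -/
lemma eq_or_eq_of_sums {y : Fin 7 → ℤ} (c : ℤ)
    (h : ∑ i, y i ^ 2 - (2 * c + 1) * ∑ i, y i + 7 * (c * (c + 1)) = 0) (i : Fin 7) :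
    y i = c ∨ y i = c + 1 := by
  have key : ∑ j, (y j - c - 1) * (y j - c - 1 + 1) = 0 := by
    rw [← h, mul_sum]
    simp only [Fin.sum_univ_succ, Fin.sum_univ_zero]
    ring
  have := (sum_eq_zero_iff_of_nonneg fun j _ => mul_succ_nonneg _).1 key i (mem_univ i)
  rcases mul_eq_zero.1 this with h | h <;> omega

lemma isNegClass_iff (x : Fin 8 → ℤ) : isNegClass x ↔ List.ofFn x ∈ negList := by
  simp only [negList, List.mem_filter, ← ofFn_K, listDot_ofFn, decide_eq_true_eq]
  refine ⟨fun h => ⟨?_, h⟩, fun h => h.2⟩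
  obtain ⟨h1, h2⟩ := h
  rw [dot_self] at h1
  rw [dot_K] at h2
  have cs := sq_sum_le_card_mul_sum_sq (s := univ) (f := fun i : Fin 7 => x i.succ)
  have e := eq_or_eq_of_sums (y := fun i => x i.succ)
  simp only [card_univ, Fintype.card_fin, Nat.cast_ofNat] at cs e
  generalize ∑ i : Fin 7, x i.succ ^ 2 = q at *
  generalize ∑ i : Fin 7, x i.succ = s at *
  obtain rfl : q = x 0 ^ 2 + 1 := by omega
  obtain rfl : s = 1 - 3 * x 0 := by omega
  have lo : 0 ≤ x 0 := by nlinarith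
  have hi : x 0 ≤ 3 := by nlinarith
  simp only [List.mem_append]
  obtain h | h | h | h : x 0 = 0 ∨ x 0 = 1 ∨ x 0 = 2 ∨ x 0 = 3 := by omega
  · exact .inl <| .inl <| .inl <| ofFn_mem_candidates h fun i => by
      simpa using e 0 (by rw [h]; norm_num) i
  · exact .inl <| .inl <| .inr <| ofFn_mem_candidates h fun i => by
      simpa using e (-1) (by rw [h]; norm_num) i
  · exact .inl <| .inr <| ofFn_mem_candidates h fun i => by
      simpa using e (-1) (by rw [h]; norm_num) i
  · exact .inr <| ofFn_mem_candidates h fun i => by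
      simpa using e (-2) (by rw [h]; norm_num) i

lemma dot_self_eq_zero_and_dot_K_iff (x : Fin 8 → ℤ) :
    dot x x = 0 ∧ dot x K = -2 ↔ List.ofFn x ∈ rulingList := by
  simp only [rulingList, List.mem_filter, ← ofFn_K, listDot_ofFn, decide_eq_true_eq]
  refine ⟨fun h => ⟨?_, h⟩, fun h => h.2⟩
  obtain ⟨h1, h2⟩ := h
  rw [dot_self] at h1
  rw [dot_K] at h2
  have cs := sq_sum_le_card_mul_sum_sq (s := univ) (f := fun i : Fin 7 => x i.succ)
  have e := eq_or_eq_of_sums (y := fun i => x i.succ)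
  have b (i : Fin 7) : (x i.succ + 1) ^ 2 ≤ ∑ j : Fin 7, (x j.succ + 1) ^ 2 :=
    single_le_sum (f := fun j : Fin 7 => (x j.succ + 1) ^ 2)
      (fun j _ => sq_nonneg _) (mem_univ i)
  simp only [add_sq, sum_add_distrib, ← mul_sum, ← sum_mul] at b
  simp only [card_univ, Fintype.card_fin, Nat.cast_ofNat, sum_const] at cs e b
  generalize ∑ i : Fin 7, x i.succ ^ 2 = q at *
  generalize ∑ i : Fin 7, x i.succ = s at *
  obtain rfl : q = x 0 ^ 2 := by omega
  obtain rfl : s = 2 - 3 * x 0 := by omega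
  have lo : 1 ≤ x 0 := by nlinarith
  have hi : x 0 ≤ 5 := by nlinarith
  simp only [List.mem_append]
  obtain h | h | h | h | h : x 0 = 1 ∨ x 0 = 2 ∨ x 0 = 3 ∨ x 0 = 4 ∨ x 0 = 5 := by omega
  · exact .inl <| .inl <| .inl <| .inl <| ofFn_mem_candidates h fun i => by
      simpa using e (-1) (by rw [h]; norm_num) i
  · exact .inl <| .inl <| .inl <| .inr <| ofFn_mem_candidates h fun i => by
      simpa using e (-1) (by rw [h]; norm_num) i
  · refine .inl <| .inl <| .inr <| ofFn_mem_candidates h fun i => ?_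
    have hb := b i
    rw [h] at hb
    norm_num at hb
    have : -3 < x i.succ := by nlinarith
    have : x i.succ < 1 := by nlinarith
    simp only [List.mem_cons, List.not_mem_nil, or_false]
    omega
  · exact .inl <| .inr <| ofFn_mem_candidates h fun i => by
      simpa using e (-2) (by rw [h]; norm_num) i
  · exact .inr <| ofFn_mem_candidates h fun i => by
      simpa using e (-2) (by rw [h]; norm_num) i

lemma ncard_ofFn_mem {α : Type*} {n : ℕ} {L : List (List α)} (hL : L.Nodup)
    (hn : ∀ l ∈ L, l.length = n) : {x : Fin n → α | List.ofFn x ∈ L}.ncard = L.length := by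
  classical
  rw [← Set.ncard_image_of_injective _ List.ofFn_injective, ← List.toFinset_card_of_nodup hL,
    ← Set.ncard_coe_finset]
  congr 1
  ext l
  simp only [Set.mem_image, Set.mem_ofPred_eq, List.coe_toFinset]
  refine ⟨fun ⟨x, hx, e⟩ => e ▸ hx, fun h => ?_⟩
  obtain rfl := hn l h
  exact ⟨l.get, by rwa [List.ofFn_get], List.ofFn_get l⟩

lemma negList_nodup : negList.Nodup := by decide +kernel

lemma length_of_mem_negList : ∀ l ∈ negList, l.length = 8 := by decide +kernel

lemma rulingList_nodup : rulingList.Nodup := by decide +kernel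

lemma length_of_mem_rulingList : ∀ l ∈ rulingList, l.length = 8 := by decide +kernel

lemma length_rulingList : rulingList.length = 126 := by decide +kernel

lemma length_filter_negList :
    ∀ r ∈ rulingList, (negList.filter fun l => listDot l r = 0).length = 12 := by
  decide +kernel

/-- The components of the singular fibres of `R`. -/
lemma ncard_isNegClass_dot_eq_zero {R : Fin 8 → ℤ} (h : dot R R = 0 ∧ dot R K = -2) :
    {x | isNegClass x ∧ dot x R = 0}.ncard = 12 := by
  rw [← length_filter_negList _ ((dot_self_eq_zero_and_dot_K_iff R).1 h),
    ← ncard_ofFn_mem (negList_nodup.filter _)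
      fun l hl => length_of_mem_negList l (List.mem_of_mem_filter hl)]
  simp only [List.mem_filter, listDot_ofFn, isNegClass_iff, decide_eq_true_eq]

lemma dot_self_add {x y : Fin 8 → ℤ} (hx : isNegClass x) (hy : isNegClass y)
    (h : dot x y = 1) : dot (x + y) (x + y) = 0 ∧ dot (x + y) K = -2 := by
  have := dot_comm x (x + y)
  have := dot_comm y (x + y)
  have := dot_comm x y
  simp only [dot_add_left, hx.1, hx.2, hy.1, hy.2] at *
  omega

lemma isNegClass_sub {R x : Fin 8 → ℤ} (h : dot R R = 0 ∧ dot R K = -2)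
    (hx : isNegClass x) (hxR : dot x R = 0) :
    isNegClass (R - x) ∧ dot x (R - x) = 1 := by
  have h1 := dot_comm R (R - x)
  have h2 := dot_comm x (R - x)
  have h3 := dot_comm R x
  simp only [isNegClass, dot_sub_left, h.1, h.2, hx.1, hx.2] at *
  omega

lemma isRuling_iff (R : Fin 8 → ℤ) : IsRuling R ↔ dot R R = 0 ∧ dot R K = -2 := by
  constructor
  · rintro ⟨x, y, hx, hy, h, rfl⟩
    exact dot_self_add hx hy h
  · intro h
    obtain ⟨x, hx, hxR⟩ := Set.nonempty_of_ncard_ne_zero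
      (by rw [ncard_isNegClass_dot_eq_zero h]; norm_num)
    obtain ⟨hy, hxy⟩ := isNegClass_sub h hx hxR
    exact ⟨x, R - x, hx, hy, hxy, (add_sub_cancel x R).symm⟩

lemma ncard_ruling_decompositions {R : Fin 8 → ℤ} (h : dot R R = 0 ∧ dot R K = -2) :
    {p : Finset (Fin 8 → ℤ) | p.card = 2 ∧ (∀ x ∈ p, isNegClass x) ∧
      (∀ x ∈ p, ∀ y ∈ p, x ≠ y → dot x y = 1) ∧ ∑ x ∈ p, x = R}.ncard = 6 := by
  classical
  have hcard := ncard_isNegClass_dot_eq_zero h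
  have hfin := Set.finite_of_ncard_ne_zero (hcard.trans_ne (by norm_num))
  lift {x | isNegClass x ∧ dot x R = 0} to Finset (Fin 8 → ℤ) using hfin with S hS
  rw [Set.ncard_coe_finset] at hcard
  have mem_S (x) : x ∈ S ↔ isNegClass x ∧ dot x R = 0 := by
    rw [← mem_coe, hS, Set.mem_ofPred_eq]
  have ne_sub {x} (hx : x ∈ S) : x ≠ R - x := fun e => by
    rw [mem_S] at hx
    have := (isNegClass_sub h hx.1 hx.2).2
    rw [← e, hx.1.1] at this
    norm_num at this
  have hT : {p : Finset (Fin 8 → ℤ) | p.card = 2 ∧ (∀ x ∈ p, isNegClass x) ∧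
      (∀ x ∈ p, ∀ y ∈ p, x ≠ y → dot x y = 1) ∧ ∑ x ∈ p, x = R} =
      ↑(S.image fun x => ({x, R - x} : Finset (Fin 8 → ℤ))) := by
    ext p
    simp only [Set.mem_ofPred_eq, coe_image, Set.mem_image, mem_coe]
    constructor
    · rintro ⟨h2, hneg, hdot, hsum⟩
      obtain ⟨x, y, hxy, rfl⟩ := card_eq_two.1 h2
      rw [sum_pair hxy] at hsum
      have hx := hneg x (by simp)
      have h1 := hdot x (by simp) y (by simp) hxy
      refine ⟨x, (mem_S x).2 ⟨hx, ?_⟩, by rw [← hsum, add_sub_cancel_left]⟩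
      rw [← hsum, dot_comm, dot_add_left, hx.1, dot_comm y, h1]
      norm_num
    · rintro ⟨x, hx, rfl⟩
      have hne := ne_sub hx
      rw [mem_S] at hx
      obtain ⟨hy, hxy⟩ := isNegClass_sub h hx.1 hx.2
      refine ⟨card_pair hne, ?_, ?_, by rw [sum_pair hne, add_sub_cancel]⟩
      · simp [hx.1, hy]
      · simp [hxy, dot_comm (R - x) x]
  rw [hT, Set.ncard_coe_finset]
  have hfib := card_eq_sum_card_image (fun x => ({x, R - x} : Finset (Fin 8 → ℤ))) S
  rw [sum_const_nat (m := 2), hcard] at hfib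
  · omega
  · simp only [mem_image]
    rintro _ ⟨x, hx, rfl⟩
    rw [← card_pair (ne_sub hx)]
    congr 1
    ext y
    simp only [mem_filter, mem_insert, mem_singleton]
    constructor
    · rintro ⟨-, e⟩
      simpa [e] using mem_insert_self y {R - y}
    · rintro (rfl | rfl)
      · exact ⟨hx, rfl⟩
      · rw [sub_sub_cancel, pair_comm, mem_S]
        rw [mem_S] at hx
        refine ⟨⟨(isNegClass_sub h hx.1 hx.2).1, ?_⟩, rfl⟩
        rw [dot_sub_left, h.1, hx.2, sub_zero]

theorem stmt10 :
    {R : Fin 8 → ℤ | IsRuling R}.ncard = 126 ∧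
    ∀ R : Fin 8 → ℤ, IsRuling R →
      {p : Finset (Fin 8 → ℤ) | p.card = 2 ∧ (∀ x ∈ p, isNegClass x) ∧
        (∀ x ∈ p, ∀ y ∈ p, x ≠ y → dot x y = 1) ∧ ∑ x ∈ p, x = R}.ncard = 6 := by
  simp only [isRuling_iff]
  refine ⟨?_, fun R => ncard_ruling_decompositions⟩
  simp only [dot_self_eq_zero_and_dot_K_iff]
  rw [ncard_ofFn_mem rulingList_nodup length_of_mem_rulingList, length_rulingList]
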